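/- There is an absolute constant C such that for all real numbers β_2, β_3 and all P ≥ 1 one has |∫_{P/2}^{P} e(β_2 x² + β_3 x³) dx| ≤ C P (1 + P²|β_2| + P³|β_3|)^{−1/2}. -/

import Mathlib

open MeasureTheory

noncomputable section

/-- `e(θ) = exp(2πiθ)`. -/
def eC (θ : ℝ) : ℂ := Complex.exp (2 * Real.pi * Complex.I * θ)

theorem norm_eC (θ : ℝ) : ‖eC θ‖ = 1 := by
  have h : (2 * Real.pi * Complex.I * θ : ℂ) = ((2 * Real.pi * θ : ℝ) : ℂ) * Complex.I := by
    push_cast; ring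
  rw [eC, h, Complex.norm_exp_ofReal_mul_I]

theorem continuous_eC : Continuous eC := by
  unfold eC
  fun_prop

theorem HasDerivAt.eC {f : ℝ → ℝ} {f' t : ℝ} (hf : HasDerivAt f f' t) :
    HasDerivAt (fun x => _root_.eC (f x))
      (2 * Real.pi * Complex.I * f' * _root_.eC (f t)) t := by
  have h := ((hf.ofReal_comp).const_mul (2 * Real.pi * Complex.I : ℂ)).cexp
  refine h.congr_deriv ?_
  rw [_root_.eC]
  ring

/-- `∫ 1 / (L² + l²) ≪ l⁻³` for the linear form `L(x) = 2a + 3bx` and `l² = 1 + |a| + |b|`. -/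
theorem integral_inv_sq_add_sq_le {a b l : ℝ} (hl : 0 < l) (hl2 : l ^ 2 = 1 + |a| + |b|) :
    ∫ x in (1 / 2 : ℝ)..1, ((2 * a + 3 * b * x) ^ 2 + l ^ 2)⁻¹ ≤ 6 / l ^ 3 := by
  have ha := abs_nonneg a
  have hb := abs_nonneg b
  have hl1 : 1 ≤ l := by nlinarith
  have hpos : ∀ x : ℝ, 0 < (2 * a + 3 * b * x) ^ 2 + l ^ 2 := fun x => by positivity
  have hcont : Continuous fun x : ℝ => ((2 * a + 3 * b * x) ^ 2 + l ^ 2)⁻¹ :=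
    Continuous.inv₀ (by fun_prop) fun x => (hpos x).ne'
  have hconst : ∀ c : ℝ, 0 < c →
      (∀ x ∈ Set.Icc (1 / 2 : ℝ) 1, c ≤ (2 * a + 3 * b * x) ^ 2 + l ^ 2) → l ^ 3 ≤ 12 * c →
      ∫ x in (1 / 2 : ℝ)..1, ((2 * a + 3 * b * x) ^ 2 + l ^ 2)⁻¹ ≤ 6 / l ^ 3 := by
    intro c hc h hlc
    calc ∫ x in (1 / 2 : ℝ)..1, ((2 * a + 3 * b * x) ^ 2 + l ^ 2)⁻¹
        ≤ ∫ _ in (1 / 2 : ℝ)..1, c⁻¹ :=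
          intervalIntegral.integral_mono_on (by norm_num) (hcont.intervalIntegrable _ _)
            (continuous_const.intervalIntegrable _ _) fun x hx => inv_anti₀ hc (h x hx)
      _ = 1 / (2 * c) := by
          rw [intervalIntegral.integral_const, smul_eq_mul]
          field_simp
          norm_num
      _ ≤ 6 / l ^ 3 := by
          rw [div_le_div_iff₀ (by positivity) (by positivity)]
          linarith
  rcases le_or_gt (3 * |b|) |a| with hab | hab
  · refine hconst (|a| ^ 2 + l ^ 2) (by positivity) (fun x hx => ?_) ?_
    · have h1 : |a| ≤ |2 * a + 3 * b * x| := by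
        have h2 : |2 * a| ≤ |2 * a + 3 * b * x| + |3 * b * x| := by
          simpa using abs_sub (2 * a + 3 * b * x) (3 * b * x)
        have h3 : |3 * b * x| ≤ |a| := by
          rw [abs_mul, abs_mul, abs_of_pos (by norm_num : (0 : ℝ) < 3),
            abs_of_nonneg (by linarith [hx.1] : 0 ≤ x)]
          nlinarith [hx.2]
        rw [abs_mul, abs_of_pos (by norm_num : (0 : ℝ) < 2)] at h2
        linarith
      have h4 := pow_le_pow_left₀ ha h1 2
      rw [sq_abs (2 * a + 3 * b * x)] at h4
      linarith
    · have h1 : l ^ 3 ≤ (l ^ 2) ^ 2 := by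
        rw [← pow_mul]
        exact pow_le_pow_right₀ hl1 (by norm_num)
      have h2 : l ^ 2 ≤ 1 + 4 / 3 * |a| := by linarith
      nlinarith [pow_le_pow_left₀ (sq_nonneg l) h2 2, sq_nonneg (|a| - 1)]
  rcases le_or_gt |b| 1 with hb1 | hb1
  · refine hconst (l ^ 2) (by positivity) (fun x _ => by nlinarith [sq_nonneg (2 * a + 3 * b * x)]) ?_
    have : l ≤ 12 := by nlinarith
    nlinarith [sq_nonneg l]
  · have hb0 : b ≠ 0 := abs_pos.1 (by linarith)
    have hderiv : ∀ x : ℝ, HasDerivAt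
        (fun y => Real.arctan ((2 * a + 3 * b * y) / l) / (3 * b * l))
        ((2 * a + 3 * b * x) ^ 2 + l ^ 2)⁻¹ x := by
      intro x
      have h1 : HasDerivAt (fun y : ℝ => (2 * a + 3 * b * y) / l) (3 * b / l) x := by
        simpa using (((hasDerivAt_id x).const_mul (3 * b)).const_add (2 * a)).div_const l
      refine (h1.arctan.div_const (3 * b * l)).congr_deriv ?_
      have h2 := (hpos x).ne'
      have h3 : 1 + ((2 * a + 3 * b * x) / l) ^ 2 = ((2 * a + 3 * b * x) ^ 2 + l ^ 2) / l ^ 2 := by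
        field_simp
        ring
      rw [h3]
      field_simp
    rw [intervalIntegral.integral_eq_sub_of_hasDerivAt (fun x _ => hderiv x)
      (hcont.intervalIntegrable _ _), ← sub_div]
    have harctan : ∀ u v : ℝ, |Real.arctan u - Real.arctan v| ≤ 3.15 := fun u v => by
      rw [abs_le]
      have := Real.pi_lt_d2
      constructor <;> linarith [Real.arctan_lt_pi_div_two u, Real.arctan_lt_pi_div_two v,
        Real.neg_pi_div_two_lt_arctan u, Real.neg_pi_div_two_lt_arctan v]
    refine (le_abs_self _).trans ?_
    rw [abs_div, abs_mul, abs_mul, abs_of_pos hl, abs_of_pos (by norm_num : (0 : ℝ) < 3)]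
    calc _ ≤ 3.15 / (3 * |b| * l) := by gcongr; exact harctan _ _
      _ ≤ 6 / l ^ 3 := by
        rw [div_le_div_iff₀ (by positivity) (by positivity)]
        have : l ^ 2 ≤ 5 * |b| := by linarith
        nlinarith [mul_le_mul_of_nonneg_right this hl.le]

theorem abs_div_sq_add_sq_le (x : ℝ) {l : ℝ} (hl : 0 < l) :
    |x| / (x ^ 2 + l ^ 2) ≤ 1 / (2 * l) := by
  rw [div_le_div_iff₀ (by positivity) (by positivity)]
  nlinarith [sq_nonneg (|x| - l), sq_abs x]

/-- The regularised reciprocal of `t L(t)`, where `L(t) = 2a + 3bt`. -/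
def regInv (a b l t : ℝ) : ℝ := (2 * a + 3 * b * t) / (t * ((2 * a + 3 * b * t) ^ 2 + l ^ 2))

/-- The derivative of `regInv`. -/
def regInvDeriv (a b l t : ℝ) : ℝ :=
  3 * b / t * ((l ^ 2 - (2 * a + 3 * b * t) ^ 2) / ((2 * a + 3 * b * t) ^ 2 + l ^ 2) ^ 2) -
    (2 * a + 3 * b * t) / (t ^ 2 * ((2 * a + 3 * b * t) ^ 2 + l ^ 2))

theorem hasDerivAt_regInv (a b : ℝ) {l t : ℝ} (hl : 0 < l) (ht : 0 < t) :
    HasDerivAt (regInv a b l) (regInvDeriv a b l t) t := by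
  have h1 : HasDerivAt (fun y : ℝ => 2 * a + 3 * b * y) (3 * b) t := by
    simpa using ((hasDerivAt_id t).const_mul (3 * b)).const_add (2 * a)
  have hD : (2 * a + 3 * b * t) ^ 2 + l ^ 2 ≠ 0 := by positivity
  refine (h1.div ((hasDerivAt_id t).mul ((h1.pow 2).add_const (l ^ 2)))
    (mul_ne_zero ht.ne' hD)).congr_deriv ?_
  simp only [regInvDeriv, id, Pi.mul_apply, Pi.pow_apply]
  field_simp
  push_cast
  ring

theorem abs_regInv_le (a b : ℝ) {l t : ℝ} (hl : 0 < l) (ht : 1 / 2 ≤ t) :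
    |regInv a b l t| ≤ 1 / l := by
  have ht0 : 0 < t := by linarith
  have hD : 0 < (2 * a + 3 * b * t) ^ 2 + l ^ 2 := by positivity
  rw [regInv, abs_div, abs_mul, abs_of_pos ht0, abs_of_pos hD, mul_comm t, ← div_div]
  calc _ ≤ 1 / (2 * l) / (1 / 2) :=
        div_le_div₀ (by positivity) (abs_div_sq_add_sq_le _ hl) (by norm_num) ht
    _ = 1 / l := by field_simp

theorem abs_regInvDeriv_le (a b : ℝ) {l t : ℝ} (hl : 0 < l) (ht : 1 / 2 ≤ t) :
    |regInvDeriv a b l t| ≤ 2 / l + 6 * |b| * ((2 * a + 3 * b * t) ^ 2 + l ^ 2)⁻¹ := by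
  have ht0 : 0 < t := by linarith
  set L := 2 * a + 3 * b * t with hL
  have hD : 0 < L ^ 2 + l ^ 2 := by positivity
  have h1 : |3 * b / t * ((l ^ 2 - L ^ 2) / (L ^ 2 + l ^ 2) ^ 2)| ≤
      6 * |b| * (L ^ 2 + l ^ 2)⁻¹ := by
    rw [abs_mul]
    gcongr
    · rw [abs_div, abs_mul, abs_of_pos ht0, abs_of_pos (by norm_num : (0 : ℝ) < 3),
        div_le_iff₀ ht0]
      nlinarith [abs_nonneg b]
    · rw [abs_div, abs_of_pos (pow_pos hD 2), div_le_iff₀ (pow_pos hD 2)]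
      have : (L ^ 2 + l ^ 2)⁻¹ * (L ^ 2 + l ^ 2) ^ 2 = L ^ 2 + l ^ 2 := by field_simp
      rw [this, abs_le]
      constructor <;> nlinarith [sq_nonneg L, sq_nonneg l]
  have h2 : |L / (t ^ 2 * (L ^ 2 + l ^ 2))| ≤ 2 / l := by
    rw [abs_div, abs_mul, abs_of_pos hD, abs_of_pos (pow_pos ht0 2), mul_comm (t ^ 2), ← div_div]
    calc _ ≤ 1 / (2 * l) / (1 / 2) ^ 2 :=
          div_le_div₀ (by positivity) (abs_div_sq_add_sq_le _ hl) (by norm_num)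
            (pow_le_pow_left₀ (by norm_num) ht 2)
      _ = 2 / l := by field_simp
  exact (abs_sub _ _).trans (by linarith)

theorem norm_integral_eC_cubic_le {a b l : ℝ} (hl : 0 < l) (hl2 : l ^ 2 = 1 + |a| + |b|) :
    ‖∫ t in (1 / 2 : ℝ)..1, eC (a * t ^ 2 + b * t ^ 3)‖ ≤ 13 / l := by
  have hpi := Real.pi_gt_three
  have hc : ‖(2 * Real.pi * Complex.I : ℂ)‖ = 2 * Real.pi := by
    simp [abs_of_pos Real.pi_pos]
  have hc0 : (2 * Real.pi * Complex.I : ℂ) ≠ 0 := by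
    rw [← norm_pos_iff, hc]
    positivity
  have hD : ∀ t : ℝ, 0 < (2 * a + 3 * b * t) ^ 2 + l ^ 2 := fun t => by positivity
  have hk : Continuous fun t : ℝ => ((2 * a + 3 * b * t) ^ 2 + l ^ 2)⁻¹ :=
    Continuous.inv₀ (by fun_prop) fun t => (hD t).ne'
  have he : Continuous fun t : ℝ => eC (a * t ^ 2 + b * t ^ 3) :=
    continuous_eC.comp (by fun_prop)
  have hmem : ∀ t ∈ Set.uIcc (1 / 2 : ℝ) 1, 1 / 2 ≤ t := fun t ht => by
    rw [Set.uIcc_of_le (by norm_num)] at ht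
    exact ht.1
  let F : ℝ → ℂ := fun t =>
    eC (a * t ^ 2 + b * t ^ 3) * (regInv a b l t : ℂ) / (2 * Real.pi * Complex.I)
  let r : ℝ → ℂ := fun t => eC (a * t ^ 2 + b * t ^ 3) *
    (((l ^ 2 * ((2 * a + 3 * b * t) ^ 2 + l ^ 2)⁻¹ : ℝ) : ℂ) -
      (regInvDeriv a b l t : ℂ) / (2 * Real.pi * Complex.I))
  have hF : ∀ t ∈ Set.uIcc (1 / 2 : ℝ) 1,
      HasDerivAt F (eC (a * t ^ 2 + b * t ^ 3) - r t) t := by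
    intro t ht
    have ht0 : 0 < t := by linarith [hmem t ht]
    have hφ : HasDerivAt (fun x : ℝ => a * x ^ 2 + b * x ^ 3) (t * (2 * a + 3 * b * t)) t := by
      refine (((hasDerivAt_pow 2 t).const_mul a).add
        ((hasDerivAt_pow 3 t).const_mul b)).congr_deriv ?_
      norm_num
      ring
    refine ((hφ.eC.mul (hasDerivAt_regInv a b hl ht0).ofReal_comp).div_const _).congr_deriv ?_
    have h1 : t * (2 * a + 3 * b * t) * regInv a b l t =
        1 - l ^ 2 * ((2 * a + 3 * b * t) ^ 2 + l ^ 2)⁻¹ := by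
      have := (hD t).ne'
      rw [regInv]
      field_simp
      ring
    have h2 := congrArg (fun x : ℝ => (x : ℂ)) h1
    simp only [Complex.ofReal_mul (t * (2 * a + 3 * b * t)), Complex.ofReal_sub,
      Complex.ofReal_one] at h2
    rw [div_eq_iff hc0]
    have h3 : (regInvDeriv a b l t : ℂ) / (2 * Real.pi * Complex.I) *
      (2 * Real.pi * Complex.I) = regInvDeriv a b l t := div_mul_cancel₀ _ hc0
    simp only [r]
    linear_combination (2 * Real.pi * Complex.I * eC (a * t ^ 2 + b * t ^ 3)) * h2 -
      eC (a * t ^ 2 + b * t ^ 3) * h3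
  have hr : IntervalIntegrable r volume (1 / 2) 1 := by
    apply ContinuousOn.intervalIntegrable
    have hd : ContinuousOn (regInvDeriv a b l) (Set.uIcc (1 / 2 : ℝ) 1) := by
      intro t ht
      have ht0 : 0 < t := by linarith [hmem t ht]
      have := (hD t).ne'
      apply ContinuousAt.continuousWithinAt
      unfold regInvDeriv
      fun_prop (disch := positivity)
    refine he.continuousOn.mul (ContinuousOn.sub ?_ ?_)
    · exact (Complex.continuous_ofReal.comp (continuous_const.mul hk)).continuousOn
    · exact (Complex.continuous_ofReal.comp_continuousOn hd).div_const _
  have hint := he.intervalIntegrable (μ := volume) (1 / 2) 1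
  have hsplit : ∫ t in (1 / 2 : ℝ)..1, eC (a * t ^ 2 + b * t ^ 3) =
      F 1 - F (1 / 2) + ∫ t in (1 / 2 : ℝ)..1, r t := by
    rw [← intervalIntegral.integral_eq_sub_of_hasDerivAt hF (hint.sub hr),
      intervalIntegral.integral_sub hint hr, sub_add_cancel]
  have hFle : ∀ t : ℝ, 1 / 2 ≤ t → ‖F t‖ ≤ 1 / (4 * l) := by
    intro t ht
    simp only [F]
    rw [norm_div, norm_mul, norm_eC, hc, one_mul, Complex.norm_real, Real.norm_eq_abs]
    calc _ ≤ 1 / l / 4 := by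
          gcongr
          · exact abs_regInv_le a b hl ht
          · linarith
      _ = _ := by field_simp
  have hrle : ∀ t : ℝ, 1 / 2 ≤ t →
      ‖r t‖ ≤ 1 / l + 2 * l ^ 2 * ((2 * a + 3 * b * t) ^ 2 + l ^ 2)⁻¹ := by
    intro t ht
    have hk0 := inv_pos.2 (hD t)
    have hg := abs_regInvDeriv_le a b hl ht
    simp only [r]
    rw [norm_mul, norm_eC, one_mul]
    refine (norm_sub_le _ _).trans ?_
    rw [norm_div, hc, Complex.norm_real, Complex.norm_real, Real.norm_eq_abs, Real.norm_eq_abs,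
      abs_of_pos (mul_pos (pow_pos hl 2) hk0)]
    have h1 : |regInvDeriv a b l t| / (2 * Real.pi) ≤
        (2 / l + 6 * |b| * ((2 * a + 3 * b * t) ^ 2 + l ^ 2)⁻¹) / 6 := by
      gcongr
      linarith
    have h2 : |b| * ((2 * a + 3 * b * t) ^ 2 + l ^ 2)⁻¹ ≤
        l ^ 2 * ((2 * a + 3 * b * t) ^ 2 + l ^ 2)⁻¹ := by
      gcongr
      linarith [abs_nonneg a]
    have h3 : 2 / l = 2 * (1 / l) := by ring
    have h4 : 0 < 1 / l := by positivity
    linarith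
  have hrint : ‖∫ t in (1 / 2 : ℝ)..1, r t‖ ≤ 1 / (2 * l) + 12 / l := by
    have hg1 : IntervalIntegrable (fun t : ℝ =>
        2 * l ^ 2 * ((2 * a + 3 * b * t) ^ 2 + l ^ 2)⁻¹) volume (1 / 2) 1 :=
      (continuous_const.mul hk).intervalIntegrable _ _
    have hg0 : IntervalIntegrable (fun _ : ℝ => 1 / l) volume (1 / 2) 1 :=
      continuous_const.intervalIntegrable _ _
    refine (intervalIntegral.norm_integral_le_of_norm_le (by norm_num)
      (ae_of_all _ fun t ht => hrle t ht.1.le) (hg0.add hg1)).trans ?_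
    rw [intervalIntegral.integral_add hg0 hg1, intervalIntegral.integral_const_mul,
      intervalIntegral.integral_const, smul_eq_mul]
    have h1 : 2 * l ^ 2 * (6 / l ^ 3) = 12 / l := by field_simp; norm_num
    have h2 : (1 - 1 / 2) * (1 / l) = 1 / (2 * l) := by field_simp; norm_num
    rw [h2, ← h1]
    gcongr
    exact integral_inv_sq_add_sq_le hl hl2
  rw [hsplit]
  have h1 := norm_add_le (F 1 - F (1 / 2)) (∫ t in (1 / 2 : ℝ)..1, r t)
  have h2 := norm_sub_le (F 1) (F (1 / 2))
  have h3 := hFle 1 (by norm_num)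
  have h4 := hFle (1 / 2) le_rfl
  have h5 : 13 / l = 1 / (4 * l) + 1 / (4 * l) + (1 / (2 * l) + 12 / l) := by
    field_simp; norm_num
  linarith

/-- Lemma 5.2 of Brandes–Parsell: there is an absolute
constant `C` with `|∫_{P/2}^P e(β₂x² + β₃x³) dx| ≤ C P (1 + P²|β₂| + P³|β₃|)^{-1/2}`
for all real `β₂, β₃` and all `P ≥ 1`. -/
theorem statement16 :
    ∃ C : ℝ, ∀ β₂ β₃ P : ℝ, 1 ≤ P →
      ‖∫ x in (P / 2)..P, eC (β₂ * x ^ 2 + β₃ * x ^ 3)‖ ≤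
        C * P * (1 + P ^ 2 * |β₂| + P ^ 3 * |β₃|) ^ (-(1 : ℝ) / 2) := by
  refine ⟨13, fun β₂ β₃ P hP => ?_⟩
  have hP0 : 0 < P := by linarith
  have hM : 0 < 1 + P ^ 2 * |β₂| + P ^ 3 * |β₃| := by positivity
  have hscale : ∫ x in (P / 2)..P, eC (β₂ * x ^ 2 + β₃ * x ^ 3) =
      P * ∫ t in (1 / 2 : ℝ)..1, eC (P ^ 2 * β₂ * t ^ 2 + P ^ 3 * β₃ * t ^ 3) := by
    have h := intervalIntegral.smul_integral_comp_mul_left (a := 1 / 2) (b := 1)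
      (fun x : ℝ => eC (β₂ * x ^ 2 + β₃ * x ^ 3)) P
    rw [mul_one, mul_one_div] at h
    rw [← h, Complex.real_smul]
    congr 3
    ext t
    congr 1
    ring
  have hsqrt : (1 + P ^ 2 * |β₂| + P ^ 3 * |β₃|) ^ (-(1 : ℝ) / 2) =
      (√(1 + P ^ 2 * |β₂| + P ^ 3 * |β₃|))⁻¹ := by
    rw [neg_div, Real.rpow_neg hM.le, ← Real.sqrt_eq_rpow]
  rw [hscale, hsqrt, norm_mul, Complex.norm_real, Real.norm_of_nonneg hP0.le, mul_comm 13 P,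
    mul_assoc, ← div_eq_mul_inv]
  refine mul_le_mul_of_nonneg_left
    (norm_integral_eC_cubic_le (Real.sqrt_pos.2 hM) ?_) hP0.le
  rw [Real.sq_sqrt hM.le, abs_mul, abs_mul, abs_of_pos (pow_pos hP0 2), abs_of_pos (pow_pos hP0 3)]

end
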